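/- Every linear binary function is matroidal: if f is a binary function on ground set E that is {0,1}-valued and satisfies f(X)=f(Y)=1 ⟹ f(X Δ Y)=1 for all X,Y ⊆ E, then f is rankable and its rank function Qf satisfies R0, R1 (with k=1), R2 and R3. -/

import Mathlib

/-- A binary function on finite ground set `E`: a function `f : 2^E → ℝ` with `f ∅ = 1`.
(The function is defined on all finite sets; only its values on subsets of `E` matter.) -/
structure BinaryFunction (α : Type) [DecidableEq α] where
  E : Finset α
  f : Finset α → ℝ
  empty_one : f ∅ = 1

namespace BinaryFunction

variable {α : Type} [DecidableEq α]

/-- Contraction of a single element: `(f/e)(Y) = f(Y)` on ground set `E ∖ {e}`. -/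
def contract (g : BinaryFunction α) (e : α) : BinaryFunction α :=
  ⟨g.E.erase e, g.f, g.empty_one⟩

/-- Deletion of a single element: `(f∖e)(Y) = (f(Y) + f(Y ∪ {e})) / (1 + f({e}))`
on ground set `E ∖ {e}`; well defined iff `1 + f({e}) ≠ 0` (in which case the
`if` branch below agrees with the formula, since the formula gives `1` at `∅`). -/
noncomputable def delete (g : BinaryFunction α) (e : α) : BinaryFunction α :=
  ⟨g.E.erase e,
   fun Y => if Y = ∅ then 1 else (g.f Y + g.f (Y ∪ {e})) / (1 + g.f {e}),
   by simp⟩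

/-- Contraction of a set: `(f/X)(Y) = f(Y)` on ground set `E ∖ X`. -/
def contractSet (g : BinaryFunction α) (X : Finset α) : BinaryFunction α :=
  ⟨g.E \ X, g.f, g.empty_one⟩

/-- Deletion of a set: `(f∖X)(Y) = (∑_{Z ⊆ X} f(Y ∪ Z)) / (∑_{Z ⊆ X} f(Z))`
on ground set `E ∖ X`; well defined iff `∑_{Z ⊆ X} f(Z) ≠ 0` (in which case the
`if` branch agrees with the formula, since the formula gives `1` at `∅`). -/
noncomputable def deleteSet (g : BinaryFunction α) (X : Finset α) : BinaryFunction α :=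
  ⟨g.E \ X,
   fun Y => if Y = ∅ then 1 else
     (∑ Z ∈ X.powerset, g.f (Y ∪ Z)) / (∑ Z ∈ X.powerset, g.f Z),
   by simp⟩

/-- `IsMinorOf m f`: `m` is obtained from `f` by a sequence of single-element
contractions and deletions, each step being well defined. -/
inductive IsMinorOf : BinaryFunction α → BinaryFunction α → Prop
  | refl (f : BinaryFunction α) : IsMinorOf f f
  | contract {f g : BinaryFunction α} (e : α) (he : e ∈ g.E)
      (h : IsMinorOf g f) : IsMinorOf (g.contract e) f
  | delete {f g : BinaryFunction α} (e : α) (he : e ∈ g.E)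
      (hw : 1 + g.f {e} ≠ 0) (h : IsMinorOf g f) : IsMinorOf (g.delete e) f

/-- `f` is stable: every sequence of single-element contractions and deletions applied
to `f` is well defined at every step, i.e. at every reachable minor `g`, deletion of any
ground-set element is well defined. -/
def Stable (f : BinaryFunction α) : Prop :=
  ∀ g : BinaryFunction α, IsMinorOf g f → ∀ e ∈ g.E, 1 + g.f {e} ≠ 0

/-- Isomorphism of binary functions: a bijection `φ` of ground sets with
`f(X) = f'(φ(X))` for all `X ⊆ E`. -/
def Isomorphic (g g' : BinaryFunction α) : Prop :=
  ∃ φ : α → α, Set.InjOn φ ↑g.E ∧ g.E.image φ = g'.E ∧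
    ∀ X ⊆ g.E, g.f X = g'.f (X.image φ)

/-- `f_α`: the order-one binary function on ground set `{e}` with value `α` on `{e}`. -/
def fAlpha (e : α) (a : ℝ) : BinaryFunction α :=
  ⟨{e}, fun X => if X = ∅ then 1 else a, by simp⟩

/-- The rank function `Qf(X) = log₂((∑_{Y ⊆ E} f(Y)) / (∑_{Y ⊆ E∖X} f(Y)))`. -/
noncomputable def Q (g : BinaryFunction α) (X : Finset α) : ℝ :=
  Real.logb 2 ((∑ Y ∈ g.E.powerset, g.f Y) / (∑ Y ∈ (g.E \ X).powerset, g.f Y))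

/-- `f` is rankable: for every `X ⊆ E` the denominator in `Qf(X)` is nonzero and
the quotient is strictly positive. -/
def Rankable (g : BinaryFunction α) : Prop :=
  ∀ X ⊆ g.E, (∑ Y ∈ (g.E \ X).powerset, g.f Y) ≠ 0 ∧
    0 < (∑ Y ∈ g.E.powerset, g.f Y) / (∑ Y ∈ (g.E \ X).powerset, g.f Y)

/-- `f` is `k`-polymatroidal: rankable, with `Qf` satisfying R0–R3. -/
def Polymatroidal (k : ℕ) (g : BinaryFunction α) : Prop :=
  Rankable g ∧
  (∀ X ⊆ g.E, ∃ n : ℕ, g.Q X = n) ∧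
  (∀ X ⊆ g.E, g.Q X ≤ (k : ℝ) * X.card) ∧
  (∀ X ⊆ g.E, ∀ e ∈ g.E, e ∉ X → g.Q X ≤ g.Q (insert e X)) ∧
  (∀ X ⊆ g.E, ∀ a ∈ g.E, ∀ b ∈ g.E, a ∉ X → b ∉ X → a ≠ b →
    g.Q X + g.Q (insert a (insert b X)) ≤ g.Q (insert a X) + g.Q (insert b X))

/-- `f` is linear: `{0,1}`-valued on subsets of `E`, and closed under symmetric
difference of supports. -/
def Linear (g : BinaryFunction α) : Prop :=
  (∀ X ⊆ g.E, g.f X = 0 ∨ g.f X = 1) ∧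
  (∀ X ⊆ g.E, ∀ Y ⊆ g.E, g.f X = 1 → g.f Y = 1 → g.f (symmDiff X Y) = 1)

/-- The order-two excluded minor `g`: value `1` on sets of size `0,1`, `-1` on size `2`. -/
def gTwo (a b : α) : BinaryFunction α :=
  ⟨{a, b}, fun X => if X.card = 2 then -1 else 1, by simp⟩

/-- The order-four excluded minor `f_{U_{2,4}}`: `1` on sizes `0,3`, `0` on sizes `1,2`,
`-1` on size `4`. -/
def fU24 (a b c d : α) : BinaryFunction α :=
  ⟨{a, b, c, d},
   fun X => if X.card = 0 then 1 else if X.card ≤ 2 then 0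
            else if X.card = 3 then 1 else -1,
   by simp⟩

/-- The order-two excluded minors `f_{α,β,γ}` of the `k`-polymatroidal binary functions. -/
def fABG (a b : α) (p q r : ℕ) : BinaryFunction α :=
  ⟨{a, b},
   fun X =>
     if X = ∅ then 1
     else if X = {a} then 2 ^ (p + r - q + 1) - 1
     else if X = {b} then 2 ^ (r + 1) - 1
     else 2 ^ (p + r + 1) - 2 ^ (r + 1) - 2 ^ (p + r - q + 1) + 1,
   by simp⟩

end BinaryFunction

namespace BinaryFunction

variable {α : Type} [DecidableEq α]

/-- The sum of a binary function over all subsets of `A`. -/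
noncomputable def subsetSum (f : BinaryFunction α) (A : Finset α) : ℝ :=
  ∑ Y ∈ A.powerset, f.f Y

lemma Linear.subsetSum_pos {f : BinaryFunction α} (hf : f.Linear) {A : Finset α}
    (hA : A ⊆ f.E) : 0 < f.subsetSum A := by
  have hnonneg : ∀ Y ∈ A.powerset, 0 ≤ f.f Y := fun Y hY => by
    rcases hf.1 Y ((Finset.mem_powerset.1 hY).trans hA) with h | h <;> simp [h]
  have hle := Finset.single_le_sum hnonneg (Finset.empty_mem_powerset A)
  rw [f.empty_one] at hle
  exact one_pos.trans_le hle

/-- Symmetric difference with a set in the support of a linear binary function does not change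
its value. -/
lemma Linear.f_symmDiff {f : BinaryFunction α} (hf : f.Linear) {X Y : Finset α}
    (hX : X ⊆ f.E) (hY : Y ⊆ f.E) (h : f.f Y = 1) : f.f (symmDiff X Y) = f.f X := by
  have hXY : symmDiff X Y ⊆ f.E :=
    symmDiff_le_sup.trans (sup_le hX hY)
  rcases hf.1 X hX with h0 | h1
  · rcases hf.1 _ hXY with h2 | h2
    · rw [h0, h2]
    · have h3 := hf.2 _ hXY Y hY h2 h
      rw [symmDiff_symmDiff_cancel_right] at h3
      rw [h2, h3]
  · rw [h1, hf.2 X hX Y hY h1 h]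

lemma Linear.subsetSum_insert_of_exists {f : BinaryFunction α} (hf : f.Linear) {A : Finset α}
    {e : α} (hA : A ⊆ f.E) (he : e ∈ f.E) (heA : e ∉ A)
    (h : ∃ Y ⊆ A, f.f (insert e Y) = 1) :
    f.subsetSum (insert e A) = 2 * f.subsetSum A := by
  obtain ⟨Z, hZ, hfZ⟩ := h
  have hsum : ∑ Y ∈ A.powerset, f.f (insert e Y) = ∑ Y ∈ A.powerset, f.f Y := by
    refine Finset.sum_nbij' (fun Y => symmDiff Y Z) (fun Y => symmDiff Y Z) ?_ ?_ ?_ ?_ ?_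
    · intro Y hY
      exact Finset.mem_powerset.2
        (symmDiff_le_sup.trans (sup_le (Finset.mem_powerset.1 hY) hZ))
    · intro Y hY
      exact Finset.mem_powerset.2
        (symmDiff_le_sup.trans (sup_le (Finset.mem_powerset.1 hY) hZ))
    · intro Y _
      exact symmDiff_symmDiff_cancel_right _ _
    · intro Y _
      exact symmDiff_symmDiff_cancel_right _ _
    · intro Y hY
      have hYA := Finset.mem_powerset.1 hY
      have heq : symmDiff Y Z = symmDiff (insert e Y) (insert e Z) := by
        have heY : e ∉ Y := fun h => heA (hYA h)
        have heZ : e ∉ Z := fun h => heA (hZ h)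
        ext x
        simp only [Finset.mem_symmDiff, Finset.mem_insert]
        by_cases hx : x = e <;> simp [hx, heY, heZ]
      rw [heq]
      exact (hf.f_symmDiff (Finset.insert_subset he (hYA.trans hA))
        (Finset.insert_subset he (hZ.trans hA)) hfZ).symm
  rw [subsetSum, Finset.sum_powerset_insert heA, hsum, subsetSum, two_mul]

lemma Linear.subsetSum_insert_of_not_exists {f : BinaryFunction α} (hf : f.Linear)
    {A : Finset α} {e : α} (hA : A ⊆ f.E) (he : e ∈ f.E) (heA : e ∉ A)
    (h : ¬ ∃ Y ⊆ A, f.f (insert e Y) = 1) :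
    f.subsetSum (insert e A) = f.subsetSum A := by
  rw [subsetSum, Finset.sum_powerset_insert heA, subsetSum, add_eq_left]
  refine Finset.sum_eq_zero fun Y hY => ?_
  have hYA := Finset.mem_powerset.1 hY
  exact (hf.1 _ (Finset.insert_subset he (hYA.trans hA))).resolve_right
    fun h1 => h ⟨Y, hYA, h1⟩

lemma Linear.Q_eq_sub {f : BinaryFunction α} (hf : f.Linear) (X : Finset α) :
    f.Q X = Real.logb 2 (f.subsetSum f.E) - Real.logb 2 (f.subsetSum (f.E \ X)) :=
  Real.logb_div (hf.subsetSum_pos subset_rfl).ne'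
    (hf.subsetSum_pos Finset.sdiff_subset).ne'

lemma sdiff_eq_insert_sdiff_insert {E X : Finset α} {e : α} (he : e ∈ E) (heX : e ∉ X) :
    E \ X = insert e (E \ insert e X) := by
  ext x
  simp only [Finset.mem_sdiff, Finset.mem_insert]
  by_cases hx : x = e <;> simp [hx, he, heX]

lemma Linear.Q_insert_of_exists {f : BinaryFunction α} (hf : f.Linear) {X : Finset α} {e : α}
    (he : e ∈ f.E) (heX : e ∉ X) (h : ∃ Y ⊆ f.E \ insert e X, f.f (insert e Y) = 1) :
    f.Q (insert e X) = f.Q X + 1 := by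
  rw [hf.Q_eq_sub, hf.Q_eq_sub, sdiff_eq_insert_sdiff_insert he heX,
    hf.subsetSum_insert_of_exists Finset.sdiff_subset he (by simp) h,
    Real.logb_mul two_ne_zero (hf.subsetSum_pos Finset.sdiff_subset).ne',
    Real.logb_self_eq_one one_lt_two]
  ring

lemma Linear.Q_insert_of_not_exists {f : BinaryFunction α} (hf : f.Linear) {X : Finset α}
    {e : α} (he : e ∈ f.E) (heX : e ∉ X)
    (h : ¬ ∃ Y ⊆ f.E \ insert e X, f.f (insert e Y) = 1) :
    f.Q (insert e X) = f.Q X := by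
  rw [hf.Q_eq_sub, hf.Q_eq_sub, sdiff_eq_insert_sdiff_insert he heX,
    hf.subsetSum_insert_of_not_exists Finset.sdiff_subset he (by simp) h]

lemma Linear.Q_insert {f : BinaryFunction α} (hf : f.Linear) {X : Finset α} {e : α}
    (he : e ∈ f.E) (heX : e ∉ X) :
    f.Q (insert e X) = f.Q X ∨ f.Q (insert e X) = f.Q X + 1 := by
  by_cases h : ∃ Y ⊆ f.E \ insert e X, f.f (insert e Y) = 1
  · exact Or.inr (hf.Q_insert_of_exists he heX h)
  · exact Or.inl (hf.Q_insert_of_not_exists he heX h)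

lemma Linear.exists_Q_eq_natCast {f : BinaryFunction α} (hf : f.Linear) {X : Finset α}
    (hX : X ⊆ f.E) : ∃ n : ℕ, f.Q X = n ∧ n ≤ X.card := by
  induction X using Finset.induction_on with
  | empty => exact ⟨0, by simp [hf.Q_eq_sub], le_rfl⟩
  | insert e X heX ih =>
    obtain ⟨n, hn, hle⟩ := ih ((Finset.subset_insert e X).trans hX)
    rw [Finset.card_insert_of_notMem heX]
    rcases hf.Q_insert (hX (Finset.mem_insert_self e X)) heX with h | h
    · exact ⟨n, by rw [h, hn], by lia⟩
    · exact ⟨n + 1, by rw [h, hn]; push_cast; rfl, by lia⟩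

lemma Linear.Q_submodular {f : BinaryFunction α} (hf : f.Linear) {X : Finset α} {a b : α}
    (ha : a ∈ f.E) (haX : a ∉ X) (hab : a ≠ b) :
    f.Q X + f.Q (insert a (insert b X)) ≤ f.Q (insert a X) + f.Q (insert b X) := by
  have habX : a ∉ insert b X := by simp [hab, haX]
  by_cases h : ∃ Y ⊆ f.E \ insert a (insert b X), f.f (insert a Y) = 1
  · have h' : ∃ Y ⊆ f.E \ insert a X, f.f (insert a Y) = 1 := by
      obtain ⟨Y, hY, hfY⟩ := h
      exact ⟨Y, hY.trans (Finset.sdiff_subset_sdiff subset_rfl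
        (Finset.insert_subset_insert a (Finset.subset_insert b X))), hfY⟩
    rw [hf.Q_insert_of_exists ha habX h, hf.Q_insert_of_exists ha haX h']
    linarith
  · rw [hf.Q_insert_of_not_exists ha habX h]
    rcases hf.Q_insert ha haX with h' | h' <;> linarith

end BinaryFunction

open BinaryFunction in
/-- Every linear binary function is matroidal: it is rankable and its
rank function satisfies R0, R1 (with `k = 1`), R2 and R3. -/
theorem linear_is_matroidal {α : Type} [DecidableEq α] (f : BinaryFunction α)
    (h01 : ∀ X ⊆ f.E, f.f X = 0 ∨ f.f X = 1)
    (hlin : ∀ X ⊆ f.E, ∀ Y ⊆ f.E, f.f X = 1 → f.f Y = 1 → f.f (symmDiff X Y) = 1) :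
    f.Rankable ∧
    (∀ X ⊆ f.E, ∃ n : ℕ, f.Q X = n) ∧
    (∀ X ⊆ f.E, f.Q X ≤ (1 : ℝ) * X.card) ∧
    (∀ X ⊆ f.E, ∀ e ∈ f.E, e ∉ X → f.Q X ≤ f.Q (insert e X)) ∧
    (∀ X ⊆ f.E, ∀ a ∈ f.E, ∀ b ∈ f.E, a ∉ X → b ∉ X → a ≠ b →
      f.Q X + f.Q (insert a (insert b X)) ≤ f.Q (insert a X) + f.Q (insert b X)) := by
  have hf : f.Linear := ⟨h01, hlin⟩
  refine ⟨fun X _ => ?_, fun X hX => ?_, fun X hX => ?_, fun X _ e he heX => ?_,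
    fun X _ a ha b _ haX _ hab => hf.Q_submodular ha haX hab⟩
  · have hpos := hf.subsetSum_pos (Finset.sdiff_subset : f.E \ X ⊆ f.E)
    exact ⟨hpos.ne', div_pos (hf.subsetSum_pos subset_rfl) hpos⟩
  · obtain ⟨n, hn, -⟩ := hf.exists_Q_eq_natCast hX
    exact ⟨n, hn⟩
  · obtain ⟨n, hn, hle⟩ := hf.exists_Q_eq_natCast hX
    rw [hn, one_mul]
    exact_mod_cast hle
  · rcases hf.Q_insert he heX with h | h <;> linarith
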